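/- Let H = (h_0, …, h_j) be a Gorenstein sequence with h_0 = 1, h_1 = 4, h_2 = 7, socle degree j ≥ 6, and h_3 ≤ 10. Then there exists a graded Artinian Gorenstein quotient A = R/I of R = K[w,x,y,z] with Hilbert function H such that the 3-dimensional space of quadrics I_2 has no common linear factor, i.e., there is no nonzero linear form ℓ ∈ R_1 with I_2 ⊆ ℓ·R_1. -/

import Mathlib

open MvPolynomial

noncomputable section

/-- The Hilbert function of the graded quotient `R/I`, where
`R = K[x_1,...,x_n]`: the dimension of the image in `R/I` of the space of
degree-`i` homogeneous forms. -/
def hilb (n : ℕ) (K : Type*) [Field K] (I : Ideal (MvPolynomial (Fin n) K)) (i : ℕ) : ℕ :=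
  Module.finrank K
    ((homogeneousSubmodule (Fin n) K i).map (Ideal.Quotient.mkₐ K I).toLinearMap)

/-- The socle `(0 : A_+)` of `A = R/I`: the elements killed by (the images of)
all the variables, equivalently by the irrelevant maximal ideal. -/
def socleSub (n : ℕ) (K : Type*) [Field K] (I : Ideal (MvPolynomial (Fin n) K)) :
    Submodule K (MvPolynomial (Fin n) K ⧸ I) :=
  ⨅ k : Fin n, LinearMap.ker (LinearMap.mulLeft K (Ideal.Quotient.mk I (X k)))

/-- A homogeneous (graded) ideal: one containing each homogeneous component of
each of its elements. -/
def IdealHomog {n : ℕ} {K : Type*} [Field K] (I : Ideal (MvPolynomial (Fin n) K)) : Prop :=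
  ∀ f ∈ I, ∀ d : ℕ, homogeneousComponent d f ∈ I

/-- `R/I` is a graded Artinian Gorenstein quotient of `R = K[x_1,...,x_n]`
of socle degree `j`: `I` is homogeneous, `R/I` is finite dimensional over `K`
with 1-dimensional socle, and `j` is the top nonzero degree. -/
def IsAG (n : ℕ) (K : Type*) [Field K] (I : Ideal (MvPolynomial (Fin n) K)) (j : ℕ) : Prop :=
  IdealHomog I ∧ FiniteDimensional K (MvPolynomial (Fin n) K ⧸ I) ∧
    Module.finrank K (socleSub n K I) = 1 ∧
    hilb n K I j ≠ 0 ∧ ∀ i, j < i → hilb n K I i = 0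

/-- Macaulay's bound `c^{(d)}`: writing `c = C(k_d,d) + ... + C(k_1,1)` with
`k_d > k_d-1 > ... > k_1 ≥ 0` (the `d`-th Macaulay expansion, computed greedily),
`c^{(d)} = C(k_d+1,d+1) + ... + C(k_1+1,2)`; by convention `0^{(d)} = 0`. -/
def macB : ℕ → ℕ → ℕ
  | _, 0 => 0
  | c, (d+1) =>
    if c = 0 then 0 else
      let k := Nat.findGreatest (fun k => Nat.choose k (d+1) ≤ c) (c + d + 1)
      Nat.choose (k+1) (d+2) + macB (c - Nat.choose k (d+1)) d

/-- `(t_0, ..., t_m)` is an O-sequence: `t_0 = 1` and `t_{i+1} ≤ t_i^{(i)}`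
for `1 ≤ i ≤ m-1`. -/
def IsOSeq (t : ℕ → ℕ) (m : ℕ) : Prop :=
  t 0 = 1 ∧ ∀ i, 1 ≤ i → i + 1 ≤ m → t (i + 1) ≤ macB (t i) i

/-- `ΔH_{≤ m}` is an O-sequence: the first differences `ΔH_i = h_i - h_{i-1}`
(with `ΔH_0 = 1`) are nonnegative for `i ≤ m`, and `(ΔH_0, ..., ΔH_m)` is an
O-sequence. -/
def DeltaOSeq (h : ℕ → ℕ) (m : ℕ) : Prop :=
  (∀ i, 1 ≤ i → i ≤ m → h (i - 1) ≤ h i) ∧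
    IsOSeq (fun i => if i = 0 then 1 else h i - h (i - 1)) m


section AGhelpers

variable {K : Type*} [Field K]

theorem hs_fin (n i : ℕ) : FiniteDimensional K (homogeneousSubmodule (Fin n) K i) :=
  Module.Finite.iff_fg.mpr (homogeneousSubmodule_fg (Fin n) K i)

theorem finrank_hs (n i : ℕ) :
    Module.finrank K (homogeneousSubmodule (Fin n) K i) = n.multichoose i := by
  classical
  have hset : {d : Fin n →₀ ℕ | d.degree = i} = {d : Fin n →₀ ℕ | d.sum (fun _ => id) = i} := by
    ext d; simp [Finsupp.degree_apply, Finsupp.sum]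
  rw [homogeneousSubmodule_eq_finsupp_supported,
    (AddMonoidAlgebra.supportedEquivFinsupp _).finrank_eq, hset]
  have e := Sym.equivNatSum (Fin n) i
  have : Fintype {P : Fin n →₀ ℕ // P.sum (fun _ => id) = i} := Fintype.ofEquiv _ e
  have h2 : Fintype {d : Fin n →₀ ℕ | d.sum (fun _ => id) = i} := this
  rw [Module.finrank_finsupp_self, ← Nat.card_eq_fintype_card]
  have h3 : Nat.card {d : Fin n →₀ ℕ | d.sum (fun _ => id) = i} = Nat.card (Sym (Fin n) i) :=
    (Nat.card_congr e).symm
  rw [h3, Nat.card_eq_fintype_card, Sym.card_sym_eq_multichoose, Fintype.card_fin]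

/-- The pairing of degree `i` and degree `k` forms induced by a functional. -/
def pairing (n : ℕ) (ψ : MvPolynomial (Fin n) K →ₗ[K] K) (i k : ℕ) :
    homogeneousSubmodule (Fin n) K i →ₗ[K] homogeneousSubmodule (Fin n) K k →ₗ[K] K :=
  ((LinearMap.mul K (MvPolynomial (Fin n) K)).compr₂ ψ).domRestrict₁₂ _ _

theorem pairing_apply (n : ℕ) (ψ : MvPolynomial (Fin n) K →ₗ[K] K) (i k : ℕ)
    (f : homogeneousSubmodule (Fin n) K i) (g : homogeneousSubmodule (Fin n) K k) :
    pairing n ψ i k f g = ψ (f.1 * g.1) := rfl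

/-- Rank of the pairing. -/
def rho (n : ℕ) (ψ : MvPolynomial (Fin n) K →ₗ[K] K) (i k : ℕ) : ℕ :=
  Module.finrank K (LinearMap.range (pairing n ψ i k))

theorem finrank_range_flip {V W : Type*} [AddCommGroup V] [Module K V] [AddCommGroup W] [Module K W]
    [FiniteDimensional K V] [FiniteDimensional K W] (b : V →ₗ[K] W →ₗ[K] K) :
    Module.finrank K (LinearMap.range b) = Module.finrank K (LinearMap.range b.flip) := by
  have h : b.flip = b.dualMap ∘ₗ (Module.evalEquiv K W).toLinearMap := by
    ext w v; rfl
  rw [h, LinearMap.range_comp, LinearEquiv.range, ← LinearMap.range_eq_map,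
    LinearMap.finrank_range_dualMap_eq_finrank_range]

theorem rho_symm (n : ℕ) (ψ : MvPolynomial (Fin n) K →ₗ[K] K) (i k : ℕ) :
    rho n ψ i k = rho n ψ k i := by
  have := hs_fin (K := K) n i
  have := hs_fin (K := K) n k
  unfold rho
  rw [finrank_range_flip]
  have h : (pairing n ψ i k).flip = pairing n ψ k i := by
    ext f g
    change ψ (_ * _) = ψ (_ * _)
    rw [mul_comm]
  rw [h]

theorem finrank_range_eq_of_ker {V W W' : Type*} [AddCommGroup V] [Module K V] [AddCommGroup W]
    [Module K W] [AddCommGroup W'] [Module K W'] [FiniteDimensional K V]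
    (f : V →ₗ[K] W) (g : V →ₗ[K] W') (h : ∀ v, f v = 0 ↔ g v = 0) :
    Module.finrank K (LinearMap.range f) = Module.finrank K (LinearMap.range g) := by
  have h1 := f.finrank_range_add_finrank_ker
  have h2 := g.finrank_range_add_finrank_ker
  have h3 : LinearMap.ker f = LinearMap.ker g := by
    ext v; simp [h]
  rw [h3] at h1
  omega

/-- `φ` is a dual functional of `I` in socle degree `j`. -/
def IsDualFun (n : ℕ) (I : Ideal (MvPolynomial (Fin n) K)) (j : ℕ)
    (φ : MvPolynomial (Fin n) K →ₗ[K] K) : Prop :=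
  ∀ i k, i + k = j → ∀ f : MvPolynomial (Fin n) K, f.IsHomogeneous i →
    (f ∈ I ↔ ∀ g : MvPolynomial (Fin n) K, g.IsHomogeneous k → φ (f * g) = 0)

/-- The dimension of the image of `ℓ * R_i` in `R/I`. -/
theorem finrank_mul_image (n : ℕ) (I : Ideal (MvPolynomial (Fin n) K)) (j : ℕ)
    (φ : MvPolynomial (Fin n) K →ₗ[K] K) (hφ : IsDualFun n I j φ) (ℓ : MvPolynomial (Fin n) K)
    (d : ℕ) (hℓ : ℓ.IsHomogeneous d) (i k : ℕ) (hik : i + d + k = j) :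
    Module.finrank K ((homogeneousSubmodule (Fin n) K i).map
      ((Ideal.Quotient.mkₐ K I).toLinearMap ∘ₗ LinearMap.mulLeft K ℓ)) =
      rho n (φ ∘ₗ LinearMap.mulLeft K ℓ) i k := by
  have := hs_fin (K := K) n i
  unfold rho
  rw [← LinearMap.range_domRestrict]
  apply finrank_range_eq_of_ker
  intro v
  have hv : (ℓ * v.1).IsHomogeneous (i + d) := by
    rw [add_comm]; exact hℓ.mul v.2
  have h1 := hφ (i + d) k hik _ hv
  have h2 : ((((Ideal.Quotient.mkₐ K I).toLinearMap ∘ₗ LinearMap.mulLeft K ℓ).domRestrict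
      (homogeneousSubmodule (Fin n) K i)) v = 0) ↔ ℓ * v.1 ∈ I := by
    simp [LinearMap.domRestrict_apply, Ideal.Quotient.eq_zero_iff_mem, -map_mul]
  rw [h2, h1]
  constructor
  · intro h
    ext g
    simpa [pairing_apply, mul_assoc] using h g.1 g.2
  · intro h g hg
    have := congrArg (fun m => m ⟨g, hg⟩) h
    simpa [pairing_apply, mul_assoc] using this

theorem hilb_eq_rho (n : ℕ) (I : Ideal (MvPolynomial (Fin n) K)) (j : ℕ)
    (φ : MvPolynomial (Fin n) K →ₗ[K] K) (hφ : IsDualFun n I j φ)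
    (i k : ℕ) (hik : i + k = j) : hilb n K I i = rho n φ i k := by
  have h := finrank_mul_image n I j φ hφ 1 0 (isHomogeneous_one _ _) i k (by omega)
  have e : LinearMap.mulLeft K (1 : MvPolynomial (Fin n) K) = LinearMap.id := by
    ext; simp
  rw [e, LinearMap.comp_id, LinearMap.comp_id] at h
  exact h

theorem mk_eq_zero' (n : ℕ) (I : Ideal (MvPolynomial (Fin n) K)) (f : MvPolynomial (Fin n) K) :
    (Ideal.Quotient.mkₐ K I).toLinearMap f = 0 ↔ f ∈ I := by
  simp [Ideal.Quotient.eq_zero_iff_mem]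

theorem mem_of_hilb_zero (n : ℕ) (I : Ideal (MvPolynomial (Fin n) K)) (i : ℕ)
    (h : hilb n K I i = 0) (f : MvPolynomial (Fin n) K) (hf : f.IsHomogeneous i) : f ∈ I := by
  have := hs_fin (K := K) n i
  unfold hilb at h
  rw [Submodule.finrank_eq_zero] at h
  rw [← mk_eq_zero', ← Submodule.mem_bot K, ← h]
  exact Submodule.mem_map_of_mem hf

theorem hilb_zero_of_mem (n : ℕ) (I : Ideal (MvPolynomial (Fin n) K)) (i : ℕ)
    (h : ∀ f : MvPolynomial (Fin n) K, f.IsHomogeneous i → f ∈ I) : hilb n K I i = 0 := by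
  have := hs_fin (K := K) n i
  unfold hilb
  rw [Submodule.finrank_eq_zero, eq_bot_iff]
  rintro _ ⟨f, hf, rfl⟩
  exact (mk_eq_zero' n I f).mpr (h f hf)

theorem mem_socle (n : ℕ) (I : Ideal (MvPolynomial (Fin n) K)) (f : MvPolynomial (Fin n) K) :
    (Ideal.Quotient.mkₐ K I).toLinearMap f ∈ socleSub n K I ↔ ∀ k, X k * f ∈ I := by
  unfold socleSub
  simp only [Submodule.mem_iInf, LinearMap.mem_ker, LinearMap.mulLeft_apply]
  refine forall_congr' fun k => ?_
  rw [← Ideal.Quotient.eq_zero_iff_mem, map_mul]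
  rfl

theorem exists_dualFun (n : ℕ) (I : Ideal (MvPolynomial (Fin n) K)) (j : ℕ)
    (h : IsAG n K I j) : ∃ φ, IsDualFun n I j φ := by
  obtain ⟨hhom, hfin, hsoc, hj, htop⟩ := h
  set mk := (Ideal.Quotient.mkₐ K I).toLinearMap with hmk
  have hle : (homogeneousSubmodule (Fin n) K j).map mk ≤ socleSub n K I := by
    rintro _ ⟨f, hf, rfl⟩
    rw [mem_socle]
    intro k
    exact mem_of_hilb_zero n I (1 + j) (htop _ (by omega)) _ ((isHomogeneous_X K k).mul hf)
  have heq : (homogeneousSubmodule (Fin n) K j).map mk = socleSub n K I := by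
    apply Submodule.eq_of_le_of_finrank_le hle
    rw [hsoc]
    exact Nat.one_le_iff_ne_zero.mpr hj
  obtain ⟨v, hv0, hv⟩ := finrank_eq_one_iff'.mp hsoc
  obtain ⟨lam, hlam⟩ : ∃ lam : Module.Dual K (MvPolynomial (Fin n) K ⧸ I), lam v.1 ≠ 0 := by
    by_contra hc
    push Not at hc
    exact hv0 (Subtype.ext ((Module.forall_dual_apply_eq_zero_iff K _).mp hc))
  have hlam0 : ∀ x ∈ socleSub n K I, lam x = 0 → x = 0 := by
    intro x hx hx0
    obtain ⟨c, hc⟩ := hv ⟨x, hx⟩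
    have hc' : c • v.1 = x := congrArg Subtype.val hc
    rw [← hc', map_smul, smul_eq_mul, mul_eq_zero] at hx0
    rcases hx0 with hx0 | hx0
    · rw [← hc', hx0, zero_smul]
    · exact absurd hx0 hlam
  refine ⟨lam ∘ₗ mk ∘ₗ homogeneousComponent j, ?_⟩
  have key : ∀ k i, i + k = j → ∀ f : MvPolynomial (Fin n) K, f.IsHomogeneous i →
      (∀ g : MvPolynomial (Fin n) K, g.IsHomogeneous k →
        (lam ∘ₗ mk ∘ₗ homogeneousComponent j) (f * g) = 0) → f ∈ I := by
    intro k
    induction k with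
    | zero =>
      intro i hi f hf hg
      have h1 := hg 1 (isHomogeneous_one _ _)
      obtain rfl : i = j := by omega
      rw [mul_one, LinearMap.comp_apply, LinearMap.comp_apply, homogeneousComponent_eq_self hf] at h1
      rw [← mk_eq_zero']
      exact hlam0 _ (hle (Submodule.mem_map_of_mem hf)) h1
    | succ k ih =>
      intro i hi f hf hg
      have hs : mk f ∈ socleSub n K I := by
        rw [mem_socle]
        intro m
        apply ih (1 + i) (by omega) _ ((isHomogeneous_X K m).mul hf)
        intro g hg'
        have := hg (X m * g) (by rw [add_comm]; exact (isHomogeneous_X K m).mul hg')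
        rw [← this]
        congr 1
        ring
      rw [← heq] at hs
      obtain ⟨f', hf', hff⟩ := hs
      have hsub : f - f' ∈ I := by
        rw [← mk_eq_zero', map_sub, sub_eq_zero]
        exact hff.symm
      have := hhom _ hsub i
      rw [map_sub, homogeneousComponent_eq_self hf,
        homogeneousComponent_of_mem hf', if_neg (by omega), sub_zero] at this
      exact this
  intro i k hik f hf
  refine ⟨fun hfI g _ => ?_, key k i hik f hf⟩
  have h1 : homogeneousComponent j (f * g) ∈ I := hhom _ (I.mul_mem_right g hfI) j
  rw [LinearMap.comp_apply, LinearMap.comp_apply, (mk_eq_zero' n I _).mpr h1, map_zero]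

end AGhelpers

section Shape

variable {K : Type*} [Field K]

theorem hc_mul (n : ℕ) (ℓ : MvPolynomial (Fin n) K) (e : ℕ) (hℓ : ℓ.IsHomogeneous e)
    (a : MvPolynomial (Fin n) K) (d : ℕ) :
    homogeneousComponent (e + d) (ℓ * a) = ℓ * homogeneousComponent d a := by
  conv_lhs => rw [← sum_homogeneousComponent a, Finset.mul_sum, map_sum]
  have h1 : ∀ i, homogeneousComponent (e + d) (ℓ * homogeneousComponent i a) =
      if i = d then ℓ * homogeneousComponent d a else 0 := by
    intro i
    rw [homogeneousComponent_of_mem (m := e + d) (n := e + i)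
      (hℓ.mul (homogeneousComponent_isHomogeneous i a))]
    by_cases hi : i = d
    · subst hi; simp
    · rw [if_neg (by omega), if_neg hi]
  simp only [h1]
  rw [Finset.sum_ite_eq' ]
  split_ifs with h
  · rfl
  · rw [homogeneousComponent_eq_zero d a (by simpa using h), mul_zero]

theorem hs_mul (n a b : ℕ) : homogeneousSubmodule (Fin n) K (a + b) =
    homogeneousSubmodule (Fin n) K a * homogeneousSubmodule (Fin n) K b := by
  rw [← homogeneousSubmodule_one_pow, pow_add, homogeneousSubmodule_one_pow,
    homogeneousSubmodule_one_pow]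

theorem finrank_inter (n : ℕ) (I : Ideal (MvPolynomial (Fin n) K)) (i : ℕ) :
    Module.finrank K (homogeneousSubmodule (Fin n) K i ⊓ I.restrictScalars K :
      Submodule K (MvPolynomial (Fin n) K)) + hilb n K I i = n.multichoose i := by
  have := hs_fin (K := K) n i
  rw [← finrank_hs (K := K) n i]
  unfold hilb
  rw [← LinearMap.range_domRestrict]
  rw [← LinearMap.finrank_range_add_finrank_ker ((Ideal.Quotient.mkₐ K I).toLinearMap.domRestrict
      (homogeneousSubmodule (Fin n) K i)), add_comm]
  congr 1
  have h : (LinearMap.ker ((Ideal.Quotient.mkₐ K I).toLinearMap.domRestrict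
      (homogeneousSubmodule (Fin n) K i))).map (homogeneousSubmodule (Fin n) K i).subtype =
      homogeneousSubmodule (Fin n) K i ⊓ I.restrictScalars K := by
    ext f
    constructor
    · rintro ⟨g, hg, rfl⟩
      exact ⟨g.2, (mk_eq_zero' n I g.1).mp hg⟩
    · rintro ⟨h1, h2⟩
      exact ⟨⟨f, h1⟩, (mk_eq_zero' n I f).mpr h2, rfl⟩
  rw [← h]
  exact (LinearEquiv.finrank_eq (Submodule.equivMapOfInjective _
    (homogeneousSubmodule (Fin n) K i).injective_subtype _)).symm

/-- Points on a hyperplane avoiding two hypersurfaces. -/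
theorem exists_point [Infinite K] (n : ℕ) (w p q : MvPolynomial (Fin n) K)
    (hw : w.IsHomogeneous 1) (hw0 : w ≠ 0)
    (hp : ¬ w ∣ p) (hq : ¬ w ∣ q) :
    ∃ P : Fin n → K, eval P w = 0 ∧ eval P p ≠ 0 ∧ eval P q ≠ 0 := by
  have hwm : w ∈ Submodule.span K (Set.range (X : Fin n → MvPolynomial (Fin n) K)) := by
    rw [← homogeneousSubmodule_one_eq_span_X]; exact hw
  obtain ⟨c, hc⟩ := (Submodule.mem_span_range_iff_exists_fun K).mp hwm
  obtain ⟨k, hk⟩ : ∃ k, c k ≠ 0 := by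
    by_contra h
    push Not at h
    apply hw0
    rw [← hc]
    simp [h]
  let σ : MvPolynomial (Fin n) K →ₐ[K] MvPolynomial (Fin n) K :=
    aeval (fun i => X i - (if i = k then (c k)⁻¹ • w else 0))
  have hσw : σ w = 0 := by
    have e1 : σ w = ∑ i, c i • (X i - (if i = k then (c k)⁻¹ • w else 0)) := by
      conv_lhs => rw [← hc]
      rw [map_sum]
      refine Finset.sum_congr rfl fun i _ => ?_
      rw [map_smul]
      simp only [σ, aeval_X]
    rw [e1]
    simp only [smul_sub, Finset.sum_sub_distrib, hc, smul_ite, smul_zero]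
    rw [Finset.sum_ite_eq' ]
    simp [smul_smul, hk]
  have hσ : ∀ f, w ∣ f - σ f := by
    intro f
    rw [← Ideal.mem_span_singleton, ← Ideal.Quotient.eq_zero_iff_mem, map_sub, sub_eq_zero]
    have : (Ideal.Quotient.mkₐ K (Ideal.span {w})) =
        (Ideal.Quotient.mkₐ K (Ideal.span {w})).comp σ := by
      apply MvPolynomial.algHom_ext
      intro i
      simp only [AlgHom.comp_apply, σ, aeval_X, map_sub]
      split_ifs
      · rw [map_smul]
        have : (Ideal.Quotient.mkₐ K (Ideal.span {w})) w = 0 :=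
          Ideal.Quotient.eq_zero_iff_mem.mpr (Ideal.mem_span_singleton_self w)
        rw [this]; simp
      · simp
    exact DFunLike.congr_fun this f
  have h0 : ∀ f, ¬ w ∣ f → σ f ≠ 0 := by
    intro f hf h
    have := hσ f
    rw [h, sub_zero] at this
    exact hf this
  have hne : σ p * σ q ≠ 0 := mul_ne_zero (h0 p hp) (h0 q hq)
  obtain ⟨x, hx⟩ : ∃ x, eval x (σ p * σ q) ≠ 0 := by
    by_contra h
    push Not at h
    exact hne (MvPolynomial.funext (fun x => by rw [h x, map_zero]))
  have hev : ∀ f, eval (fun i => eval x (σ (X i))) f = eval x (σ f) := by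
    intro f
    have : (aeval (fun i => eval x (σ (X i))) : MvPolynomial (Fin n) K →ₐ[K] K) =
        (aeval x : MvPolynomial (Fin n) K →ₐ[K] K).comp σ := by
      apply MvPolynomial.algHom_ext
      intro i
      simp [aeval_eq_eval]
    have := DFunLike.congr_fun this f
    simpa [aeval_eq_eval] using this
  refine ⟨fun i => eval x (σ (X i)), ?_, ?_, ?_⟩
  · rw [hev, hσw, map_zero]
  · rw [hev]; intro h; apply hx; rw [map_mul, h, zero_mul]
  · rw [hev]; intro h; apply hx; rw [map_mul, h, mul_zero]

theorem ker_two {V W : Type*} [AddCommGroup V] [Module K V] [AddCommGroup W] [Module K W]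
    (f : V →ₗ[K] W) (h : Module.finrank K (LinearMap.ker f) = 2) :
    ∃ x y : V, ∀ v, f v = 0 → ∃ a b : K, a • x + b • y = v := by
  have : FiniteDimensional K (LinearMap.ker f) := Module.finite_of_finrank_eq_succ h
  let bs := Module.finBasisOfFinrankEq K (LinearMap.ker f) h
  refine ⟨(bs 0).1, (bs 1).1, fun v hv => ?_⟩
  have h3 := bs.sum_repr ⟨v, hv⟩
  rw [Fin.sum_univ_two] at h3
  exact ⟨_, _, congrArg Subtype.val h3⟩

/-- If `I` contains `w u`, `w u'` and `f` as below then modulo two linear forms everything in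
degree at least three lies in `I`. -/
theorem exists_two_forms (I : Ideal (MvPolynomial (Fin 4) K)) (hhom : IdealHomog I)
    (w u u' f : MvPolynomial (Fin 4) K) (hw : w.IsHomogeneous 1) (hu : u.IsHomogeneous 1)
    (hu' : u'.IsHomogeneous 1) (hf : f.IsHomogeneous 3)
    (hwu : w * u ∈ I) (hwu' : w * u' ∈ I) (hfI : f ∈ I) (P Q : Fin 4 → K)
    (hwP : eval P w = 0) (hfP : eval P f ≠ 0) (huP : eval P u ≠ 0) (huP' : eval P u' = 0)
    (hwQ : eval Q w ≠ 0) (huQ' : eval Q u' ≠ 0) :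
    ∃ ℓ t : MvPolynomial (Fin 4) K, ℓ.IsHomogeneous 1 ∧ t.IsHomogeneous 1 ∧
      ∀ d, 2 ≤ d → ∀ g : MvPolynomial (Fin 4) K, g.IsHomogeneous (d + 1) →
        ∃ a b : MvPolynomial (Fin 4) K, a.IsHomogeneous d ∧ b.IsHomogeneous d ∧
          g - ℓ * a - t * b ∈ I := by
  have := hs_fin (K := K) 4 1
  let ev : homogeneousSubmodule (Fin 4) K 1 →ₗ[K] K × K :=
    ((aeval P : MvPolynomial (Fin 4) K →ₐ[K] K).toLinearMap.prod
      (aeval Q : MvPolynomial (Fin 4) K →ₐ[K] K).toLinearMap).domRestrict _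
  have hev : ∀ v, ev v = (eval P v.1, eval Q v.1) := by
    intro v; simp [ev, aeval_eq_eval, LinearMap.domRestrict_apply]
  have hsurj : Function.Surjective ev := by
    rintro ⟨x, y⟩
    refine ⟨(x / eval P u) • ⟨u, hu⟩ + ((y - x / eval P u * eval Q u) / eval Q w) • ⟨w, hw⟩, ?_⟩
    rw [map_add, map_smul, map_smul, hev, hev]
    ext
    · simp [hwP, huP]
    · simp [hwQ]
  have hker : Module.finrank K (LinearMap.ker ev) = 2 := by
    have h1 := ev.finrank_range_add_finrank_ker
    rw [LinearMap.range_eq_top.mpr hsurj, finrank_top, finrank_hs] at h1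
    have h2 : Module.finrank K (K × K) = 2 := by simp
    have h3 : Nat.multichoose 4 1 = 4 := by simp
    omega
  obtain ⟨⟨ℓ, hℓ1⟩, ⟨t, ht1⟩, hbs⟩ := ker_two ev hker
  rw [mem_homogeneousSubmodule] at hℓ1 ht1
  let J : Ideal (MvPolynomial (Fin 4) K) := I ⊔ Ideal.span {ℓ, t}
  have hIJ : I ≤ J := le_sup_left
  have hℓJ : ℓ ∈ J := (le_sup_right : Ideal.span {ℓ, t} ≤ J) (Ideal.subset_span (by simp))
  have htJ : t ∈ J := (le_sup_right : Ideal.span {ℓ, t} ≤ J) (Ideal.subset_span (by simp))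
  let π := Ideal.Quotient.mkₐ K J
  have hπ : ∀ g, π g = 0 ↔ g ∈ J := fun g => Ideal.Quotient.eq_zero_iff_mem
  have hker0 : ∀ v : homogeneousSubmodule (Fin 4) K 1, eval P v.1 = 0 → eval Q v.1 = 0 →
      π v.1 = 0 := by
    intro v h1 h2
    obtain ⟨a, b, h3⟩ := hbs v (by rw [hev, h1, h2]; rfl)
    have h4 := congrArg Subtype.val h3
    simp only [Submodule.coe_add, Submodule.coe_smul] at h4
    rw [hπ, ← h4]
    apply J.add_mem
    · rw [smul_eq_C_mul]; exact J.mul_mem_left _ hℓJ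
    · rw [smul_eq_C_mul]; exact J.mul_mem_left _ htJ
  obtain ⟨m1, hm1⟩ := hsurj (1, 0)
  obtain ⟨m2, hm2⟩ := hsurj (0, 1)
  rw [hev, Prod.mk.injEq] at hm1 hm2
  have hlin : ∀ v : MvPolynomial (Fin 4) K, v.IsHomogeneous 1 →
      π v = eval P v • π m1.1 + eval Q v • π m2.1 := by
    intro v hv
    have := hker0 (⟨v, hv⟩ - eval P v • m1 - eval Q v • m2)
      (by simp [hm1.1, hm2.1]) (by simp [hm1.2, hm2.2])
    simp only [Submodule.coe_sub, Submodule.coe_smul, map_sub, map_smul] at this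
    rw [sub_sub, sub_eq_zero] at this
    exact this
  have e1 : π m2.1 * π m2.1 = 0 := by
    have h : π (w * u') = 0 := (hπ _).mpr (hIJ hwu')
    rw [map_mul, hlin w hw, hlin u' hu', hwP, huP'] at h
    simpa [hwQ, huQ'] using h
  have e2 : π m2.1 * π m1.1 = 0 := by
    have h : π (w * u) = 0 := (hπ _).mpr (hIJ hwu)
    rw [map_mul, hlin w hw, hlin u hu, hwP] at h
    simpa [hwQ, huP, mul_add, e1] using h
  have hdeg : ∀ d, ∀ g ∈ homogeneousSubmodule (Fin 4) K (d + 2),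
      π g = eval P g • π m1.1 ^ (d + 2) := by
    intro d
    induction d with
    | zero =>
      intro g hg
      rw [show 0 + 2 = 1 + 1 from rfl, hs_mul] at hg
      refine Submodule.mul_induction_on hg ?_ ?_
      · intro a ha b hb
        have e3 : π m1.1 * π m2.1 = 0 := by rw [mul_comm, e2]
        rw [map_mul, hlin a ha, hlin b hb, map_mul]
        simp only [add_mul, mul_add, smul_mul_smul_comm, e1, e2, e3]
        simp [pow_two]
      · intro a b ha hb
        rw [map_add, ha, hb, map_add, add_smul]
    | succ d ih =>
      intro g hg
      rw [show d + 1 + 2 = 1 + (d + 2) by ring, hs_mul] at hg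
      refine Submodule.mul_induction_on hg ?_ ?_
      · intro a ha b hb
        have e3 : π m2.1 * π m1.1 ^ (d + 2) = 0 := by
          rw [pow_succ', ← mul_assoc, e2, zero_mul]
        rw [map_mul, hlin a ha, ih b hb, map_mul]
        simp only [add_mul, smul_mul_smul_comm, e3]
        simp [pow_succ']
      · intro a b ha hb
        rw [map_add, ha, hb, map_add, add_smul]
  have hm3 : π m1.1 ^ 3 = 0 := by
    have h : π f = 0 := (hπ _).mpr (hIJ hfI)
    rw [hdeg 1 f hf] at h
    simpa [hfP] using h
  refine ⟨ℓ, t, hℓ1, ht1, ?_⟩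
  intro d hd g hg
  have hgJ : g ∈ J := by
    rw [← hπ]
    obtain ⟨e, rfl⟩ : ∃ e, d = e + 2 := ⟨d - 2, by omega⟩
    rw [hdeg (e + 1) g hg, show e + 1 + 2 = e + 3 by ring, pow_add, hm3, mul_zero, smul_zero]
  obtain ⟨i, hi, s, hs, hsum⟩ := Submodule.mem_sup.mp hgJ
  obtain ⟨a, b, hab⟩ := Ideal.mem_span_pair.mp hs
  refine ⟨homogeneousComponent d a, homogeneousComponent d b,
    homogeneousComponent_isHomogeneous _ _, homogeneousComponent_isHomogeneous _ _, ?_⟩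
  rw [← hc_mul 4 ℓ 1 hℓ1, ← hc_mul 4 t 1 ht1, ← homogeneousComponent_eq_self hg,
    add_comm d 1, ← map_sub, ← map_sub]
  apply hhom
  have : g - ℓ * a - t * b = i := by
    rw [← hsum, ← hab]; ring
  rw [this]
  exact hi

theorem finrank_step {M : Type*} [AddCommGroup M] [Module K M] [FiniteDimensional K M]
    (A B C D : Submodule K M) (τ : M →ₗ[K] M) (hAB : A ≤ B) (hAC : A.map τ ≤ C)
    (hD : D ≤ C ⊔ B.map τ) :
    Module.finrank K D + Module.finrank K A ≤ Module.finrank K C + Module.finrank K B := by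
  obtain ⟨E, hE1, hE2⟩ : ∃ E : Submodule K M, A ⊔ E = B ∧ A ⊓ E = ⊥ := by
    obtain ⟨E', hE'⟩ := Submodule.exists_isCompl A
    refine ⟨E' ⊓ B, ?_, ?_⟩
    · rw [← sup_inf_assoc_of_le _ hAB, hE'.sup_eq_top, top_inf_eq]
    · rw [← inf_assoc, hE'.inf_eq_bot, bot_inf_eq]
  have h1 := Submodule.finrank_sup_add_finrank_inf_eq A E
  rw [hE1, hE2, finrank_bot] at h1
  have h2 : D ≤ C ⊔ E.map τ := by
    refine hD.trans ?_
    rw [← hE1, Submodule.map_sup]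
    exact sup_le le_sup_left (sup_le (hAC.trans le_sup_left) le_sup_right)
  have h3 := Submodule.finrank_mono h2
  have h4 := Submodule.finrank_add_le_finrank_add_finrank C (E.map τ)
  have h5 := Submodule.finrank_map_le τ E
  omega

theorem shape_of_forms (I : Ideal (MvPolynomial (Fin 4) K)) (j : ℕ) (hI : IsAG 4 K I j)
    (φ : MvPolynomial (Fin 4) K →ₗ[K] K) (hφ : IsDualFun 4 I j φ)
    (ℓ t : MvPolynomial (Fin 4) K) (hℓ : ℓ.IsHomogeneous 1) (ht : t.IsHomogeneous 1)
    (hgen : ∀ d, 2 ≤ d → ∀ g : MvPolynomial (Fin 4) K, g.IsHomogeneous (d + 1) →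
        ∃ a b : MvPolynomial (Fin 4) K, a.IsHomogeneous d ∧ b.IsHomogeneous d ∧
          g - ℓ * a - t * b ∈ I) :
    ∀ i, 1 ≤ i → i + 3 ≤ j →
      hilb 4 K I (i + 2) + hilb 4 K I i ≤ 2 * hilb 4 K I (i + 1) := by
  have := hI.2.1
  let mk := (Ideal.Quotient.mkₐ K I).toLinearMap
  let r : ℕ → ℕ := fun i => Module.finrank K ((homogeneousSubmodule (Fin 4) K i).map
      (mk ∘ₗ LinearMap.mulLeft K ℓ))
  have hr : ∀ i k, i + 1 + k = j → r i = r k := by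
    intro i k hik
    have h1 : r i = _ := finrank_mul_image 4 I j φ hφ ℓ 1 hℓ i k hik
    have h2 : r k = _ := finrank_mul_image 4 I j φ hφ ℓ 1 hℓ k i (by omega)
    rw [h1, h2, rho_symm]
  have hsym : ∀ i k, i + k = j → hilb 4 K I i = hilb 4 K I k := by
    intro i k hik
    rw [hilb_eq_rho 4 I j φ hφ i k hik, hilb_eq_rho 4 I j φ hφ k i (by omega), rho_symm]
  have hstep : ∀ i, 1 ≤ i → hilb 4 K I (i + 2) + r i ≤ r (i + 1) + hilb 4 K I (i + 1) := by
    intro i hi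
    have hmul : ∀ (s f : MvPolynomial (Fin 4) K), mk (s * f) = mk s * mk f := fun s f =>
      map_mul (Ideal.Quotient.mkₐ K I) s f
    refine finrank_step _ _ _ _ (LinearMap.mulLeft K (mk t)) ?_ ?_ ?_
    · rintro _ ⟨f, hf, rfl⟩
      refine ⟨ℓ * f, ?_, rfl⟩
      rw [add_comm]
      exact hℓ.mul hf
    · rintro _ ⟨_, ⟨f, hf, rfl⟩, rfl⟩
      refine ⟨t * f, ?_, ?_⟩
      · rw [add_comm]
        exact ht.mul hf
      · simp only [LinearMap.comp_apply, LinearMap.mulLeft_apply]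
        rw [← hmul]
        congr 1
        ring
    · rintro _ ⟨g, hg, rfl⟩
      obtain ⟨a, b, ha, hb, hab⟩ := hgen (i + 1) (by omega) g hg
      have h0 := (mk_eq_zero' 4 I _).mpr hab
      have h1 : mk g = mk (ℓ * a) + mk t * mk b := by
        rw [← hmul, ← map_add, ← sub_eq_zero, ← map_sub, ← sub_sub]
        exact h0
      change mk g ∈ _
      rw [h1]
      exact Submodule.add_mem_sup ⟨a, ha, rfl⟩ ⟨mk b, ⟨b, hb, rfl⟩, rfl⟩
  intro i hi hij
  have s1 := hstep i hi
  obtain ⟨k, rfl⟩ : ∃ k, j = i + 2 + k := ⟨j - i - 2, by omega⟩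
  have s2 := hstep k (by omega)
  rw [hsym (k + 2) i (by omega), hr k (i + 1) (by omega), hr (k + 1) i (by omega),
    hsym (k + 1) (i + 1) (by omega)] at s2
  omega

theorem shape [Infinite K] (I : Ideal (MvPolynomial (Fin 4) K)) (j : ℕ) (hj : 6 ≤ j)
    (hI : IsAG 4 K I j) (h1 : hilb 4 K I 1 = 4) (h2 : hilb 4 K I 2 = 7) (h3 : hilb 4 K I 3 ≤ 10)
    (w : MvPolynomial (Fin 4) K) (hw : w.IsHomogeneous 1) (hw0 : w ≠ 0)
    (hfac : ∀ f ∈ I, f.IsHomogeneous 2 → ∃ m : MvPolynomial (Fin 4) K,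
          m.IsHomogeneous 1 ∧ f = w * m) :
    ∀ i, 1 ≤ i → i + 3 ≤ j →
      hilb 4 K I (i + 2) + hilb 4 K I i ≤ 2 * hilb 4 K I (i + 1) := by
  obtain ⟨φ, hφ⟩ := exists_dualFun 4 I j hI
  have f1 := hs_fin (K := K) 4 1
  have f2 := hs_fin (K := K) 4 2
  have f3 := hs_fin (K := K) 4 3
  have d1 := finrank_inter 4 I 1
  have d2 := finrank_inter 4 I 2
  have d3 := finrank_inter 4 I 3
  have c1 : Nat.multichoose 4 1 = 4 := by rw [Nat.multichoose_eq]; decide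
  have c2 : Nat.multichoose 4 2 = 10 := by rw [Nat.multichoose_eq]; decide
  have c3 : Nat.multichoose 4 3 = 20 := by rw [Nat.multichoose_eq]; decide
  let V : Submodule K (MvPolynomial (Fin 4) K) := homogeneousSubmodule (Fin 4) K 1 ⊓
    (I.restrictScalars K).comap (LinearMap.mulLeft K w)
  have fV : FiniteDimensional K V :=
    Submodule.finiteDimensional_of_le (inf_le_left : V ≤ homogeneousSubmodule (Fin 4) K 1)
  have hV : 3 ≤ Module.finrank K V := by
    have hle : homogeneousSubmodule (Fin 4) K 2 ⊓ I.restrictScalars K ≤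
        V.map (LinearMap.mulLeft K w) := by
      rintro f ⟨hf2, hfI⟩
      obtain ⟨m, hm, rfl⟩ := hfac f hfI hf2
      exact ⟨m, ⟨hm, hfI⟩, rfl⟩
    have e1 := Submodule.finrank_mono hle
    have e2 := Submodule.finrank_map_le (LinearMap.mulLeft K w) V
    omega
  obtain ⟨u, huV, huw⟩ : ∃ u ∈ V, ¬ w ∣ u := by
    by_contra hc
    push Not at hc
    have hle : V ≤ Submodule.span K {w} := by
      intro u hu
      obtain ⟨a, ha⟩ := hc u hu
      have hu1 : u.IsHomogeneous 1 := hu.1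
      have e := hc_mul 4 w 1 hw a 0
      rw [← ha, add_zero, homogeneousComponent_eq_self hu1, homogeneousComponent_zero] at e
      rw [e, Submodule.mem_span_singleton]
      exact ⟨coeff 0 a, by rw [smul_eq_C_mul, mul_comm]⟩
    have e1 := Submodule.finrank_mono hle
    have e2 := finrank_span_singleton (K := K) hw0
    omega
  obtain ⟨f, hf3, hfI, hfw⟩ : ∃ f : MvPolynomial (Fin 4) K, f.IsHomogeneous 3 ∧ f ∈ I ∧ ¬ w ∣ f := by
    by_contra hc
    push Not at hc
    have hle : homogeneousSubmodule (Fin 4) K 3 ⊓ I.restrictScalars K ≤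
        (homogeneousSubmodule (Fin 4) K 2).map (LinearMap.mulLeft K w) := by
      rintro f ⟨hf3, hfI⟩
      obtain ⟨a, ha⟩ := hc f hf3 hfI
      have e := hc_mul 4 w 1 hw a 2
      have hf3' : f.IsHomogeneous (1 + 2) := hf3
      rw [← ha, homogeneousComponent_eq_self hf3'] at e
      exact ⟨_, homogeneousComponent_isHomogeneous 2 a, e.symm⟩
    have e2 := Submodule.finrank_map_le (LinearMap.mulLeft K w) (homogeneousSubmodule (Fin 4) K 2)
    rw [finrank_hs] at e2
    have heq := Submodule.eq_of_le_of_finrank_le hle (by omega)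
    have hw2 : ∀ g : MvPolynomial (Fin 4) K, g.IsHomogeneous 2 → w * g ∈ I := by
      intro g hg
      have : w * g ∈ (homogeneousSubmodule (Fin 4) K 2).map (LinearMap.mulLeft K w) := ⟨g, hg, rfl⟩
      rw [← heq] at this
      exact this.2
    have hwI : w ∈ I := by
      rw [hφ 1 (j - 1) (by omega) w hw]
      intro g hg
      have hwg : w * g ∈ I := by
        have hg' : g ∈ homogeneousSubmodule (Fin 4) K (2 + (j - 3)) := by
          rw [show 2 + (j - 3) = j - 1 by omega]; exact hg
        rw [hs_mul] at hg'
        refine Submodule.mul_induction_on hg' ?_ ?_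
        · intro a ha b _
          rw [← mul_assoc]
          exact I.mul_mem_right _ (hw2 a ha)
        · intro a b ha hb
          rw [mul_add]; exact I.add_mem ha hb
      have hh : (w * g).IsHomogeneous j := by
        have := hw.mul hg
        rwa [show 1 + (j - 1) = j by omega] at this
      have := (hφ j 0 (by omega) _ hh).mp hwg 1 (isHomogeneous_one _ _)
      rwa [mul_one] at this
    have hbot : homogeneousSubmodule (Fin 4) K 1 ⊓ I.restrictScalars K = ⊥ := by
      have : FiniteDimensional K (homogeneousSubmodule (Fin 4) K 1 ⊓ I.restrictScalars K :
        Submodule K (MvPolynomial (Fin 4) K)) := Submodule.finiteDimensional_of_le inf_le_left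
      rw [← Submodule.finrank_eq_zero (R := K)]
      omega
    have : w ∈ homogeneousSubmodule (Fin 4) K 1 ⊓ I.restrictScalars K := ⟨hw, hwI⟩
    rw [hbot, Submodule.mem_bot] at this
    exact hw0 this
  obtain ⟨P, hwP, hfP, huP⟩ := exists_point 4 w f u hw hw0 hfw huw
  obtain ⟨u', huV', hu0', huP'⟩ : ∃ u' ∈ V, u' ≠ 0 ∧ eval P u' = 0 := by
    by_contra hc
    push Not at hc
    let e : V →ₗ[K] K := (aeval P : MvPolynomial (Fin 4) K →ₐ[K] K).toLinearMap.domRestrict V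
    have hinj : Function.Injective e := by
      rw [← LinearMap.ker_eq_bot, LinearMap.ker_eq_bot']
      intro v hv
      by_contra hv0
      apply hc v.1 v.2 (fun h => hv0 (Subtype.ext h))
      simpa [e, LinearMap.domRestrict_apply, aeval_eq_eval] using hv
    have := LinearMap.finrank_le_finrank_of_injective hinj
    rw [Module.finrank_self] at this
    omega
  obtain ⟨Q, hQ⟩ : ∃ Q, eval Q (w * u') ≠ 0 := by
    by_contra hc
    push Not at hc
    exact mul_ne_zero hw0 hu0' (MvPolynomial.funext (fun x => by rw [hc x, map_zero]))
  rw [map_mul] at hQ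
  obtain ⟨ℓ, t, hℓ, ht, hgen⟩ := exists_two_forms I hI.1 w u u' f hw huV.1 huV'.1 hf3 huV.2 huV'.2
    hfI P Q hwP hfP huP huP' (left_ne_zero_of_mul hQ) (right_ne_zero_of_mul hQ)
  exact shape_of_forms I j hI φ hφ ℓ t hℓ ht hgen

end Shape

section Combinatorics

theorem exists_threshold (p : ℕ → Prop) (m : ℕ) (hp : ∀ i, i + 1 < m → p (i + 1) → p i) :
    ∃ N, N ≤ m ∧ ∀ i, i < m → (p i ↔ i < N) := by
  induction m with
  | zero => exact ⟨0, le_refl _, fun i hi => absurd hi (by omega)⟩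
  | succ m ih =>
    obtain ⟨N, hN, h⟩ := ih (fun i hi => hp i (by omega))
    by_cases hm : p m
    · have hall : ∀ k, k ≤ m → p (m - k) := by
        intro k
        induction k with
        | zero => intro _; exact hm
        | succ k ihk =>
          intro hk
          have := ihk (by omega)
          apply hp _ (by omega)
          rwa [show m - (k + 1) + 1 = m - k by omega]
      refine ⟨m + 1, le_refl _, fun i hi => ⟨fun _ => hi, fun _ => ?_⟩⟩
      have := hall (m - i) (by omega)
      rwa [show m - (m - i) = i by omega] at this
    · refine ⟨N, by omega, fun i hi => ?_⟩
      rcases Nat.lt_succ_iff_lt_or_eq.mp hi with h1 | rfl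
      · exact h i h1
      · exact ⟨fun hc => absurd hc hm, fun hc => absurd hc (by omega)⟩

theorem comb_shape (h : ℕ → ℕ) (j : ℕ) (hj : 6 ≤ j) (h0 : h 0 = 1) (h1 : h 1 = 4) (h2 : h 2 = 7)
    (hsym : ∀ i k, i + k = j → h i = h k)
    (hconc : ∀ i, 1 ≤ i → i + 3 ≤ j → h (i + 2) + h i ≤ 2 * h (i + 1)) :
    ∃ A B C, 2 ≤ C ∧ C ≤ B ∧ B ≤ A ∧ 2 * A ≤ j ∧
      ∀ i, 2 * i ≤ j → h i = 1 + min A i + min B i + min C i := by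
  let d : ℕ → ℤ := fun i => (h (i + 1) : ℤ) - h i
  have d0 : d 0 = 3 := by simp [d, h0, h1]
  have d1 : d 1 = 3 := by simp [d, h1, h2]
  have hd : ∀ i, 1 ≤ i → i + 3 ≤ j → d (i + 1) ≤ d i := by
    intro i hi hij
    have := hconc i hi hij
    simp only [d]
    rw [show i + 1 + 1 = i + 2 by ring]
    omega
  have hanti : ∀ k a, 1 ≤ a → a + k + 2 ≤ j → d (a + k) ≤ d a := by
    intro k
    induction k with
    | zero => intro a _ _; simp
    | succ k ih =>
      intro a ha hk
      exact (hd (a + k) (by omega) (by omega)).trans (ih a ha (by omega))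
  have hnonneg : ∀ i, 2 * i + 2 ≤ j → 0 ≤ d i := by
    intro i hi
    rcases Nat.eq_zero_or_pos i with rfl | hi0
    · omega
    · have e := hanti (j - 1 - 2 * i) i hi0 (by omega)
      have e2 : d (i + (j - 1 - 2 * i)) = - d i := by
        simp only [d]
        rw [hsym (i + (j - 1 - 2 * i) + 1) i (by omega), hsym (i + (j - 1 - 2 * i)) (i + 1) (by omega)]
        ring
      omega
  have hle : ∀ i, 2 * i + 2 ≤ j → d i ≤ 3 := by
    intro i hi
    rcases Nat.eq_zero_or_pos i with rfl | hi0
    · omega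
    · have := hanti (i - 1) 1 (le_refl _) (by omega)
      rw [show 1 + (i - 1) = i by omega] at this
      omega
  have hd' : ∀ i, i + 1 < j / 2 → d (i + 1) ≤ d i := by
    intro i hi
    rcases Nat.eq_zero_or_pos i with rfl | hi0
    · simp only [zero_add]; omega
    · exact hd i hi0 (by omega)
  obtain ⟨A, hA, hA'⟩ := exists_threshold (fun i => 1 ≤ d i) (j / 2)
    (fun i hi hp => hp.trans (hd' i hi))
  obtain ⟨B, hB, hB'⟩ := exists_threshold (fun i => 2 ≤ d i) (j / 2)
    (fun i hi hp => hp.trans (hd' i hi))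
  obtain ⟨C, hC, hC'⟩ := exists_threshold (fun i => 3 ≤ d i) (j / 2)
    (fun i hi hp => hp.trans (hd' i hi))
  refine ⟨A, B, C, ?_, ?_, ?_, by omega, ?_⟩
  · have := (hC' 1 (by omega)).mp (by omega)
    omega
  · by_contra hc
    have e1 := (hC' B (by omega)).mpr (by omega)
    have e2 := (hB' B (by omega)).mp (by omega)
    omega
  · by_contra hc
    have e1 := (hB' A (by omega)).mpr (by omega)
    have e2 := (hA' A (by omega)).mp (by omega)
    omega
  · intro i
    induction i with
    | zero => intro _; simp [h0]
    | succ i ih =>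
      intro hi
      have e := ih (by omega)
      have eA := hA' i (by omega)
      have eB := hB' i (by omega)
      have eC := hC' i (by omega)
      have e0 := hnonneg i (by omega)
      have e3 := hle i (by omega)
      have edef : d i = (h (i + 1) : ℤ) - h i := rfl
      omega

end Combinatorics

section Construction

variable {K : Type*} [Field K]

/-- The ideal attached to a functional. -/
def dualIdeal (n : ℕ) (φ : MvPolynomial (Fin n) K →ₗ[K] K) : Ideal (MvPolynomial (Fin n) K) where
  carrier := {f | ∀ g, φ (f * g) = 0}
  add_mem' := by
    intro a b ha hb g
    rw [add_mul, map_add, ha g, hb g, add_zero]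
  zero_mem' := by
    intro g
    rw [zero_mul, map_zero]
  smul_mem' := by
    intro c f hf g
    rw [smul_eq_mul, mul_comm c f, mul_assoc]
    exact hf _

theorem mem_dualIdeal (n : ℕ) (φ : MvPolynomial (Fin n) K →ₗ[K] K) (f : MvPolynomial (Fin n) K) :
    f ∈ dualIdeal n φ ↔ ∀ g, φ (f * g) = 0 := Iff.rfl

theorem phi_hc (n j : ℕ) (φ : MvPolynomial (Fin n) K →ₗ[K] K)
    (hsupp : ∀ d, d ≠ j → ∀ f : MvPolynomial (Fin n) K, f.IsHomogeneous d → φ f = 0)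
    (f : MvPolynomial (Fin n) K) : φ f = φ (homogeneousComponent j f) := by
  conv_lhs => rw [← sum_homogeneousComponent f, map_sum]
  have h1 : ∀ i, φ (homogeneousComponent i f) =
      if i = j then φ (homogeneousComponent j f) else 0 := by
    intro i
    split_ifs with h
    · rw [h]
    · exact hsupp i h _ (homogeneousComponent_isHomogeneous i f)
  rw [Finset.sum_congr rfl (fun i _ => h1 i), Finset.sum_ite_eq']
  split_ifs with h
  · rfl
  · rw [homogeneousComponent_eq_zero j f (by simpa using h), map_zero]

theorem mem_dualIdeal_of_gt (n j : ℕ) (φ : MvPolynomial (Fin n) K →ₗ[K] K)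
    (hsupp : ∀ d, d ≠ j → ∀ f : MvPolynomial (Fin n) K, f.IsHomogeneous d → φ f = 0)
    (d : ℕ) (hd : j < d) (f : MvPolynomial (Fin n) K) (hf : f.IsHomogeneous d) :
    f ∈ dualIdeal n φ := by
  intro g
  rw [← sum_homogeneousComponent g, Finset.mul_sum, map_sum]
  refine Finset.sum_eq_zero fun i _ => ?_
  exact hsupp (d + i) (by omega) _ (hf.mul (homogeneousComponent_isHomogeneous i g))

theorem dualIdeal_isDualFun (n j : ℕ) (φ : MvPolynomial (Fin n) K →ₗ[K] K)
    (hsupp : ∀ d, d ≠ j → ∀ f : MvPolynomial (Fin n) K, f.IsHomogeneous d → φ f = 0) :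
    IsDualFun n (dualIdeal n φ) j φ := by
  intro i k hik f hf
  refine ⟨fun h g _ => h g, fun h g => ?_⟩
  rw [phi_hc n j φ hsupp, ← hik, hc_mul n f i hf]
  exact h _ (homogeneousComponent_isHomogeneous k g)

theorem dualIdeal_homog (n j : ℕ) (φ : MvPolynomial (Fin n) K →ₗ[K] K)
    (hsupp : ∀ d, d ≠ j → ∀ f : MvPolynomial (Fin n) K, f.IsHomogeneous d → φ f = 0) :
    IdealHomog (dualIdeal n φ) := by
  intro f hf d
  rcases Nat.lt_or_ge j d with hd | hd
  · exact mem_dualIdeal_of_gt n j φ hsupp d hd _ (homogeneousComponent_isHomogeneous d f)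
  · rw [dualIdeal_isDualFun n j φ hsupp d (j - d) (by omega) _
      (homogeneousComponent_isHomogeneous d f)]
    intro g hg
    rw [mul_comm, ← hc_mul n g (j - d) hg, show j - d + d = j by omega, ← phi_hc n j φ hsupp,
      mul_comm]
    exact hf g

theorem dualIdeal_isAG (n j : ℕ) (φ : MvPolynomial (Fin n) K →ₗ[K] K)
    (hsupp : ∀ d, d ≠ j → ∀ f : MvPolynomial (Fin n) K, f.IsHomogeneous d → φ f = 0)
    (hne : φ ≠ 0) : IsAG n K (dualIdeal n φ) j := by
  have htop : ∀ i, j < i → hilb n K (dualIdeal n φ) i = 0 := fun i hi =>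
    hilb_zero_of_mem n _ i (mem_dualIdeal_of_gt n j φ hsupp i hi)
  obtain ⟨f0, hf0⟩ : ∃ f, φ f ≠ 0 := by
    by_contra h
    push Not at h
    exact hne (LinearMap.ext h)
  set f1 := homogeneousComponent j f0 with hf1
  have hf1h : f1.IsHomogeneous j := homogeneousComponent_isHomogeneous j f0
  have hf1φ : φ f1 ≠ 0 := by rwa [← phi_hc n j φ hsupp]
  let mk := (Ideal.Quotient.mkₐ K (dualIdeal n φ)).toLinearMap
  have hfin : FiniteDimensional K (MvPolynomial (Fin n) K ⧸ dualIdeal n φ) := by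
    have : FiniteDimensional K (restrictTotalDegree (Fin n) K j) := inferInstance
    refine Module.Finite.of_surjective (mk.domRestrict (restrictTotalDegree (Fin n) K j)) ?_
    intro x
    obtain ⟨f, rfl⟩ := Ideal.Quotient.mk_surjective x
    refine ⟨⟨∑ i ∈ Finset.range (j + 1), homogeneousComponent i f, ?_⟩, ?_⟩
    · refine Submodule.sum_mem _ fun i hi => ?_
      rw [mem_restrictTotalDegree]
      have := (homogeneousComponent_isHomogeneous i f).totalDegree_le
      rw [Finset.mem_range] at hi
      omega
    · change mk _ = mk f
      rw [← sub_eq_zero, ← map_sub, mk_eq_zero']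
      intro g
      rw [sub_mul, map_sub, sub_eq_zero]
      have hbig : φ (f * g) = ∑ i ∈ Finset.range (max (j + 1) (f.totalDegree + 1)),
          φ (homogeneousComponent i f * g) := by
        rw [← map_sum, ← Finset.sum_mul]
        congr 2
        conv_lhs => rw [← sum_homogeneousComponent f]
        refine Finset.sum_subset (Finset.range_mono (le_max_right _ _)) ?_
        intro i _ hi
        exact homogeneousComponent_eq_zero i f (by simpa using hi)
      rw [hbig]
      change φ ((∑ i ∈ Finset.range (j + 1), homogeneousComponent i f) * g) = _
      rw [Finset.sum_mul, map_sum]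
      refine Finset.sum_subset (Finset.range_mono (le_max_left _ _)) ?_
      intro i _ hi
      exact mem_dualIdeal_of_gt n j φ hsupp i (by rw [Finset.mem_range] at hi; omega) _
        (homogeneousComponent_isHomogeneous i f) g
  refine ⟨dualIdeal_homog n j φ hsupp, hfin, ?_, ?_, htop⟩
  · skip
    have hs1 : mk f1 ∈ socleSub n K (dualIdeal n φ) := by
      rw [mem_socle]
      intro k
      exact mem_dualIdeal_of_gt n j φ hsupp (1 + j) (by omega) _ ((isHomogeneous_X K k).mul hf1h)
    have hprop : ∀ f : MvPolynomial (Fin n) K, (∀ k, X k * f ∈ dualIdeal n φ) → φ f = 0 →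
        f ∈ dualIdeal n φ := by
      intro f hf hf0 g
      induction g using MvPolynomial.induction_on with
      | C a => rw [mul_comm, ← smul_eq_C_mul, map_smul, hf0, smul_zero]
      | add p q hp hq => rw [mul_add, map_add, hp, hq, add_zero]
      | mul_X p k _ =>
        have := hf k p
        rw [← this]
        congr 1
        ring
    rw [finrank_eq_one_iff']
    refine ⟨⟨mk f1, hs1⟩, ?_, ?_⟩
    · intro h
      have h' : mk f1 = 0 := congrArg Subtype.val h
      rw [mk_eq_zero'] at h'
      have := h' 1
      rw [mul_one] at this
      exact hf1φ this
    · rintro ⟨x, hx⟩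
      obtain ⟨f, rfl⟩ := Ideal.Quotient.mk_surjective x
      have hx' := (mem_socle n _ f).mp hx
      have hx1 := (mem_socle n _ f1).mp hs1
      refine ⟨φ f / φ f1, Subtype.ext ?_⟩
      change (φ f / φ f1) • mk f1 = mk f
      rw [← sub_eq_zero, ← map_smul, ← map_sub, mk_eq_zero']
      apply hprop
      · intro k
        rw [mul_sub, mul_smul_comm, smul_eq_C_mul]
        exact Ideal.sub_mem _ (Ideal.mul_mem_left _ _ (hx1 k)) (hx' k)
      · rw [map_sub, map_smul, smul_eq_mul, div_mul_cancel₀ _ hf1φ, sub_self]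
  · intro h
    have := mem_of_hilb_zero n _ j h f1 hf1h 1
    rw [mul_one] at this
    exact hf1φ this

theorem finrank_range_of_dual {V W ι : Type*} [AddCommGroup V] [Module K V] [AddCommGroup W]
    [Module K W] [Fintype ι] [DecidableEq ι] (b : V →ₗ[K] W →ₗ[K] K) (u : ι → V) (v : ι → W)
    (hδ : ∀ s t, b (u s) (v t) = if s = t then 1 else 0)
    (hspan : ∀ x, b x ∈ Submodule.span K (Set.range fun s => b (u s))) :
    Module.finrank K (LinearMap.range b) = Fintype.card ι := by
  have hli : LinearIndependent K (fun s => b (u s)) := by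
    rw [Fintype.linearIndependent_iff]
    intro c hc t
    have := congrArg (fun z => z (v t)) hc
    simpa [LinearMap.sum_apply, hδ] using this
  have hr : LinearMap.range b = Submodule.span K (Set.range fun s => b (u s)) := by
    apply le_antisymm
    · rintro _ ⟨x, rfl⟩
      exact hspan x
    · rw [Submodule.span_le]
      rintro _ ⟨s, rfl⟩
      exact ⟨u s, rfl⟩
  rw [hr]
  exact finrank_span_eq_card hli

end Construction

section Monomials

variable {K : Type*} [Field K]

/-- Exponent vector in four variables. -/
def ex (p q r s : ℕ) : Fin 4 →₀ ℕ := Finsupp.equivFunOnFinite.symm ![p, q, r, s]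

theorem ex_add (p q r s p' q' r' s' : ℕ) :
    ex p q r s + ex p' q' r' s' = ex (p + p') (q + q') (r + r') (s + s') := by
  ext t
  fin_cases t <;> simp [ex]

theorem ex_eta (d : Fin 4 →₀ ℕ) : d = ex (d 0) (d 1) (d 2) (d 3) := by
  ext t
  fin_cases t <;> simp [ex]

theorem ex_degree (p q r s : ℕ) : (ex p q r s).degree = p + q + r + s := by
  simp [ex, Finsupp.degree_eq_sum, Fin.sum_univ_four]

theorem ex_inj (p q r s p' q' r' s' : ℕ) :
    ex p q r s = ex p' q' r' s' ↔ p = p' ∧ q = q' ∧ r = r' ∧ s = s' := by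
  constructor
  · intro h
    have h0 := DFunLike.congr_fun h 0
    have h1 := DFunLike.congr_fun h 1
    have h2 := DFunLike.congr_fun h 2
    have h3 := DFunLike.congr_fun h 3
    simp [ex] at h0 h1 h2 h3
    exact ⟨h0, h1, h2, h3⟩
  · rintro ⟨rfl, rfl, rfl, rfl⟩
    rfl

/-- A monomial of degree `i` as an element of the space of forms. -/
def monH (K : Type*) [Field K] (i p q r s : ℕ) (h : p + q + r + s = i) :
    homogeneousSubmodule (Fin 4) K i :=
  ⟨monomial (ex p q r s) 1, by
    rw [mem_homogeneousSubmodule]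
    apply isHomogeneous_monomial
    rw [ex_degree, h]⟩

theorem mem_span_monH (i : ℕ) (x : homogeneousSubmodule (Fin 4) K i)
    (S : Submodule K (homogeneousSubmodule (Fin 4) K i))
    (hS : ∀ p q r s h, monH K i p q r s h ∈ S) : x ∈ S := by
  have hdeg : ∀ d ∈ x.1.support, d 0 + d 1 + d 2 + d 3 = i := by
    intro d hd
    have hx : x.1.IsHomogeneous i := (mem_homogeneousSubmodule _ _).mp x.2
    have := hx (mem_support_iff.mp hd)
    rwa [Pi.one_def, ← Finsupp.degree_eq_weight_one, ex_eta d, ex_degree] at this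
  have hx : x = ∑ d ∈ x.1.support.attach, coeff d.1 x.1 •
      monH K i (d.1 0) (d.1 1) (d.1 2) (d.1 3) (hdeg d.1 d.2) := by
    apply Subtype.ext
    rw [Submodule.coe_sum]
    conv_lhs => rw [x.1.as_sum, ← Finset.sum_attach]
    refine Finset.sum_congr rfl fun d _ => ?_
    change _ = coeff d.1 x.1 • monomial (ex _ _ _ _) 1
    rw [← ex_eta, smul_monomial, smul_eq_mul, mul_one]
  rw [hx]
  exact Submodule.sum_mem _ fun d _ => Submodule.smul_mem _ _ (hS _ _ _ _ _)

/-- The functional picking out three coefficients. -/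
def phi (K : Type*) [Field K] (j A B C : ℕ) : MvPolynomial (Fin 4) K →ₗ[K] K :=
  lcoeff K (ex (j - (A + 1)) (A + 1) 0 0) + lcoeff K (ex (j - (B + 1)) 0 (B + 1) 0) +
    lcoeff K (ex (j - C) 0 0 C)

/-- The exponents with nonzero value. -/
def PP (A B C q r s : ℕ) : Prop :=
  (q = A + 1 ∧ r = 0 ∧ s = 0) ∨ (q = 0 ∧ r = B + 1 ∧ s = 0) ∨ (q = 0 ∧ r = 0 ∧ s = C)

open Classical in
theorem phi_mon (j A B C p q r s : ℕ) (hA : A + 1 ≤ j) (hB : B + 1 ≤ j) (hC : C ≤ j)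
    (h : p + q + r + s = j) :
    phi K j A B C (monomial (ex p q r s) 1) = if PP A B C q r s then 1 else 0 := by
  have e : phi K j A B C (monomial (ex p q r s) 1) =
      coeff (ex (j - (A + 1)) (A + 1) 0 0) (monomial (ex p q r s) (1 : K)) +
      coeff (ex (j - (B + 1)) 0 (B + 1) 0) (monomial (ex p q r s) (1 : K)) +
      coeff (ex (j - C) 0 0 C) (monomial (ex p q r s) (1 : K)) := rfl
  rw [e, coeff_monomial, coeff_monomial, coeff_monomial]
  simp only [ex_inj]
  by_cases h1 : q = A + 1 ∧ r = 0 ∧ s = 0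
  · rw [if_pos (by omega), if_neg (by omega), if_neg (by omega), if_pos (by unfold PP; omega)]; simp
  · by_cases h2 : q = 0 ∧ r = B + 1 ∧ s = 0
    · rw [if_neg (by omega), if_pos (by omega), if_neg (by omega), if_pos (by unfold PP; omega)]; simp
    · by_cases h3 : q = 0 ∧ r = 0 ∧ s = C
      · rw [if_neg (by omega), if_neg (by omega), if_pos (by omega), if_pos (by unfold PP; omega)]; simp
      · rw [if_neg (by omega), if_neg (by omega), if_neg (by omega), if_neg (by unfold PP; omega)]; simp

theorem phi_supp (j A B C : ℕ) (hA : A + 1 ≤ j) (hB : B + 1 ≤ j) (hC : C ≤ j) :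
    ∀ d, d ≠ j → ∀ f : MvPolynomial (Fin 4) K, f.IsHomogeneous d → phi K j A B C f = 0 := by
  intro d hd f hf
  have e : phi K j A B C f = coeff (ex (j - (A + 1)) (A + 1) 0 0) f +
      coeff (ex (j - (B + 1)) 0 (B + 1) 0) f + coeff (ex (j - C) 0 0 C) f := rfl
  rw [e, hf.coeff_eq_zero, hf.coeff_eq_zero, hf.coeff_eq_zero]
  · simp
  all_goals rw [ex_degree]; omega

open Classical in
theorem pair_mon (j A B C i k : ℕ) (hik : i + k = j) (hA : A + 1 ≤ j) (hB : B + 1 ≤ j) (hC : C ≤ j)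
    (p q r s : ℕ) (h : p + q + r + s = i) (p' q' r' s' : ℕ) (h' : p' + q' + r' + s' = k) :
    pairing 4 (phi K j A B C) i k (monH K i p q r s h) (monH K k p' q' r' s' h') =
      if PP A B C (q + q') (r + r') (s + s') then 1 else 0 := by
  rw [pairing_apply]
  change phi K j A B C (monomial _ 1 * monomial _ 1) = _
  rw [monomial_mul, ex_add, one_mul]
  exact phi_mon j A B C _ _ _ _ hA hB hC (by omega)

theorem pair_ext (j A B C i k : ℕ) (hik : i + k = j) (hA : A + 1 ≤ j) (hB : B + 1 ≤ j) (hC : C ≤ j)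
    (p q r s : ℕ) (h : p + q + r + s = i) (p' q' r' s' : ℕ) (h' : p' + q' + r' + s' = i)
    (hh : ∀ t x y z, t + x + y + z = k →
      (PP A B C (q + x) (r + y) (s + z) ↔ PP A B C (q' + x) (r' + y) (s' + z))) :
    pairing 4 (phi K j A B C) i k (monH K i p q r s h) =
      pairing 4 (phi K j A B C) i k (monH K i p' q' r' s' h') := by
  classical
  ext x
  rw [← LinearMap.mem_eqLocus]
  apply mem_span_monH
  intro t a b c ht
  rw [LinearMap.mem_eqLocus, pair_mon j A B C i k hik hA hB hC, pair_mon j A B C i k hik hA hB hC]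
  exact if_congr (hh t a b c ht) rfl rfl

theorem pair_zero (j A B C i k : ℕ) (hik : i + k = j) (hA : A + 1 ≤ j) (hB : B + 1 ≤ j) (hC : C ≤ j)
    (p q r s : ℕ) (h : p + q + r + s = i)
    (hh : ∀ t x y z, t + x + y + z = k → ¬ PP A B C (q + x) (r + y) (s + z)) :
    pairing 4 (phi K j A B C) i k (monH K i p q r s h) = 0 := by
  classical
  ext x
  rw [← LinearMap.mem_eqLocus]
  apply mem_span_monH
  intro t a b c ht
  rw [LinearMap.mem_eqLocus, pair_mon j A B C i k hik hA hB hC, if_neg (hh t a b c ht)]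
  rfl

theorem rho_phi (j A B C i k : ℕ) (hik : i + k = j) (hi : i ≤ k) (hC2 : 2 ≤ C) (hCB : C ≤ B)
    (hBA : B ≤ A) (hAj : 2 * A ≤ j) :
    rho 4 (phi K j A B C) i k = 1 + min A i + min B i + min C i := by
  classical
  have hA : A + 1 ≤ j := by omega
  have hB : B + 1 ≤ j := by omega
  have hC : C ≤ j := by omega
  let u : (Unit ⊕ Fin (min A i)) ⊕ (Fin (min B i) ⊕ Fin (min C i)) →
      homogeneousSubmodule (Fin 4) K i :=
    Sum.elim (Sum.elim (fun _ => monH K i i 0 0 0 (by omega))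
      (fun e => monH K i (i - e.1 - 1) (e.1 + 1) 0 0 (by omega)))
      (Sum.elim (fun e => monH K i (i - e.1 - 1) 0 (e.1 + 1) 0 (by omega))
      (fun e => monH K i (i - e.1 - 1) 0 0 (e.1 + 1) (by omega)))
  let v : (Unit ⊕ Fin (min A i)) ⊕ (Fin (min B i) ⊕ Fin (min C i)) →
      homogeneousSubmodule (Fin 4) K k :=
    Sum.elim (Sum.elim (fun _ => monH K k (k - C) 0 0 C (by omega))
      (fun e => monH K k (k - A + e.1) (A - e.1) 0 0 (by omega)))
      (Sum.elim (fun e => monH K k (k - B + e.1) 0 (B - e.1) 0 (by omega))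
      (fun e => monH K k (k - C + e.1 + 1) 0 0 (C - e.1 - 1) (by omega)))
  have key := finrank_range_of_dual (pairing 4 (phi K j A B C) i k) u v ?_ ?_
  · unfold rho
    rw [key]
    simp
    omega
  · rintro ((s | s) | (s | s)) ((t | t) | (t | t)) <;>
    · simp only [u, v, Sum.elim_inl, Sum.elim_inr]
      rw [pair_mon j A B C i k hik hA hB hC]
      refine if_congr ?_ rfl rfl
      simp only [PP, Sum.inl.injEq, Sum.inr.injEq, reduceCtorEq, Fin.ext_iff, true_and, and_true,
        false_and, and_false, or_false, false_or, iff_true, iff_false] <;> omega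
  · intro x
    change x ∈ (Submodule.span K (Set.range fun s => pairing 4 (phi K j A B C) i k (u s))).comap
      (pairing 4 (phi K j A B C) i k)
    apply mem_span_monH
    intro p q r s h
    rw [Submodule.mem_comap]
    have hu : ∀ z y, y = pairing 4 (phi K j A B C) i k (u z) →
        y ∈ Submodule.span K (Set.range fun s => pairing 4 (phi K j A B C) i k (u s)) :=
      fun z y hy => hy ▸ Submodule.subset_span ⟨z, rfl⟩
    by_cases c0 : q = 0 ∧ r = 0 ∧ s = 0
    · apply hu (Sum.inl (Sum.inl ()))
      apply pair_ext j A B C i k hik hA hB hC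
      · try dsimp only
        omega
      intro t x y z _
      simp only [PP]; omega
    by_cases c1 : 0 < q ∧ q ≤ A ∧ r = 0 ∧ s = 0
    · apply hu (Sum.inl (Sum.inr ⟨q - 1, by omega⟩))
      apply pair_ext j A B C i k hik hA hB hC
      · try dsimp only
        omega
      intro t x y z _
      simp only [PP]; omega
    by_cases c2 : 0 < r ∧ r ≤ B ∧ q = 0 ∧ s = 0
    · apply hu (Sum.inr (Sum.inl ⟨r - 1, by omega⟩))
      apply pair_ext j A B C i k hik hA hB hC
      · try dsimp only
        omega
      intro t x y z _
      simp only [PP]; omega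
    by_cases c3 : 0 < s ∧ s ≤ C ∧ q = 0 ∧ r = 0
    · apply hu (Sum.inr (Sum.inr ⟨s - 1, by omega⟩))
      apply pair_ext j A B C i k hik hA hB hC
      · try dsimp only
        omega
      intro t x y z _
      simp only [PP]; omega
    by_cases c4 : (q = A + 1 ∧ r = 0 ∧ s = 0) ∨ (q = 0 ∧ r = B + 1 ∧ s = 0)
    · apply hu (Sum.inr (Sum.inr ⟨C - 1, by omega⟩))
      apply pair_ext j A B C i k hik hA hB hC
      · try dsimp only
        omega
      intro t x y z _
      simp only [PP]; omega
    · rw [pair_zero j A B C i k hik hA hB hC]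
      · exact Submodule.zero_mem _
      intro t x y z _
      simp only [PP]; omega

theorem phi_ne (j A B C : ℕ) (hA : A + 1 ≤ j) (hB : B + 1 ≤ j) (hC : C ≤ j) :
    phi K j A B C ≠ 0 := by
  classical
  intro h
  have := phi_mon (K := K) j A B C (j - C) 0 0 C hA hB hC (by omega)
  rw [h, if_pos (by simp [PP])] at this
  simp at this

theorem XX_mem (j A B C : ℕ) (hA : A + 1 ≤ j) (hB : B + 1 ≤ j) (hC : C ≤ j) (hj : 2 ≤ j)
    (q r s : ℕ) (h : q + r + s = 2) (hq : q ≤ 1) (hr : r ≤ 1) (hs : s ≤ 1) :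
    (monomial (ex 0 q r s) 1 : MvPolynomial (Fin 4) K) ∈ dualIdeal 4 (phi K j A B C) := by
  have hh : (monomial (ex 0 q r s) 1 : MvPolynomial (Fin 4) K).IsHomogeneous 2 :=
    isHomogeneous_monomial _ (by rw [ex_degree]; omega)
  rw [dualIdeal_isDualFun 4 j _ (phi_supp j A B C hA hB hC) 2 (j - 2) (by omega) _ hh]
  intro g hg
  have := pair_zero (K := K) j A B C 2 (j - 2) (by omega) hA hB hC 0 q r s (by omega) (by
    intro t x y z _
    simp only [PP]; omega)
  have h3 := LinearMap.congr_fun this ⟨g, (mem_homogeneousSubmodule _ _).mpr hg⟩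
  rw [pairing_apply] at h3
  exact h3

theorem linear_eval (ℓ : MvPolynomial (Fin 4) K) (hℓ : ℓ.IsHomogeneous 1) :
    ∃ c : Fin 4 → K, ∀ p : Fin 4 → K, eval p ℓ = ∑ t, c t * p t := by
  have h1 : ℓ ∈ homogeneousSubmodule (Fin 4) K 1 := (mem_homogeneousSubmodule _ _).mpr hℓ
  rw [homogeneousSubmodule_one_eq_span_X, Submodule.mem_span_range_iff_exists_fun] at h1
  obtain ⟨c, rfl⟩ := h1
  exact ⟨c, fun p => by simp [smul_eval]⟩

theorem exactly_one (a b : K) (h : ∀ s : K, s ≠ 0 → a + s * b ≠ 0) :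
    (a = 0 ∧ b ≠ 0) ∨ (a ≠ 0 ∧ b = 0) := by
  by_cases ha : a = 0
  · left
    refine ⟨ha, fun hb => h 1 one_ne_zero (by simp [ha, hb])⟩
  · right
    refine ⟨ha, ?_⟩
    by_contra hb
    apply h (-a / b) (div_ne_zero (neg_ne_zero.mpr ha) hb)
    field_simp
    ring

theorem no_common (ℓ : MvPolynomial (Fin 4) K) (hℓ : ℓ.IsHomogeneous 1)
    (h12 : ℓ ∣ monomial (ex 0 1 1 0) 1) (h13 : ℓ ∣ monomial (ex 0 1 0 1) 1)
    (h23 : ℓ ∣ monomial (ex 0 0 1 1) 1) : False := by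
  obtain ⟨c, hc⟩ := linear_eval ℓ hℓ
  have key : ∀ (p : Fin 4 → K) (q r s : ℕ), ℓ ∣ monomial (ex 0 q r s) 1 →
      p 1 ^ q * p 2 ^ r * p 3 ^ s ≠ 0 → c 0 * p 0 + c 1 * p 1 + c 2 * p 2 + c 3 * p 3 ≠ 0 := by
    rintro p q r s ⟨m, hm⟩ hne h0
    apply hne
    have := congrArg (eval p) hm
    rw [map_mul, hc, Fin.sum_univ_four, h0, zero_mul, eval_monomial,
      Finsupp.prod_fintype _ _ (by simp), Fin.prod_univ_four] at this
    simpa [ex] using this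
  have e12 := exactly_one (c 1) (c 2) (fun s hs => by
    have := key ![0, 1, s, 0] 1 1 0 h12 (by simpa using hs)
    simpa [mul_comm] using this)
  have e13 := exactly_one (c 1) (c 3) (fun s hs => by
    have := key ![0, 1, 0, s] 1 0 1 h13 (by simpa using hs)
    simpa [mul_comm] using this)
  have e23 := exactly_one (c 2) (c 3) (fun s hs => by
    have := key ![0, 0, 1, s] 0 1 1 h23 (by simpa using hs)
    simpa [mul_comm] using this)
  tauto

end Monomials

/-- If `H = (1,4,7,h_3,...)` is a Gorenstein sequence of socle
degree `j ≥ 6` with `h_3 ≤ 10`, then some graded Artinian Gorenstein quotient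
`R/I` of `R = K[w,x,y,z]` with Hilbert function `H` has the property that its
space of quadrics `I_2` has no common linear factor. -/
theorem statement_3 {K : Type*} [Field K] [IsAlgClosed K] [CharZero K]
    (j : ℕ) (hj : 6 ≤ j) (h : ℕ → ℕ)
    (h0 : h 0 = 1) (h1 : h 1 = 4) (h2 : h 2 = 7) (h3 : h 3 ≤ 10)
    (hGor : ∃ I₀ : Ideal (MvPolynomial (Fin 4) K), IsAG 4 K I₀ j ∧
      ∀ i, hilb 4 K I₀ i = h i) :
    ∃ I : Ideal (MvPolynomial (Fin 4) K), IsAG 4 K I j ∧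
      (∀ i, hilb 4 K I i = h i) ∧
      ¬ ∃ ℓ : MvPolynomial (Fin 4) K, ℓ.IsHomogeneous 1 ∧ ℓ ≠ 0 ∧
        ∀ f ∈ I, f.IsHomogeneous 2 → ∃ m : MvPolynomial (Fin 4) K,
          m.IsHomogeneous 1 ∧ f = ℓ * m := by

  obtain ⟨I₀, hAG, hH⟩ := hGor
  by_cases hno : ∃ ℓ : MvPolynomial (Fin 4) K, ℓ.IsHomogeneous 1 ∧ ℓ ≠ 0 ∧
        ∀ f ∈ I₀, f.IsHomogeneous 2 → ∃ m : MvPolynomial (Fin 4) K,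
          m.IsHomogeneous 1 ∧ f = ℓ * m
  · obtain ⟨w, hw, hw0, hfac⟩ := hno
    have : Infinite K := inferInstance
    have hconc := shape I₀ j hj hAG (by rw [hH, h1]) (by rw [hH, h2]) (by rw [hH]; exact h3)
      w hw hw0 hfac
    simp only [hH] at hconc
    obtain ⟨ψ, hψ⟩ := exists_dualFun 4 I₀ j hAG
    have hsym : ∀ i k, i + k = j → h i = h k := by
      intro i k hik
      rw [← hH, ← hH, hilb_eq_rho 4 I₀ j ψ hψ i k hik, hilb_eq_rho 4 I₀ j ψ hψ k i (by omega),
        rho_symm]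
    obtain ⟨A, B, C, hC2, hCB, hBA, hAj, hs⟩ := comb_shape h j hj h0 h1 h2 hsym hconc
    have hA : A + 1 ≤ j := by omega
    have hB : B + 1 ≤ j := by omega
    have hC : C ≤ j := by omega
    have hsupp := phi_supp (K := K) j A B C hA hB hC
    have hAG' := dualIdeal_isAG 4 j (phi K j A B C) hsupp (phi_ne j A B C hA hB hC)
    have hD := dualIdeal_isDualFun 4 j (phi K j A B C) hsupp
    refine ⟨dualIdeal 4 (phi K j A B C), hAG', ?_, ?_⟩
    · intro i
      rcases Nat.lt_or_ge j i with hi | hi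
      · rw [hAG'.2.2.2.2 i hi, ← hH, hAG.2.2.2.2 i hi]
      · rw [hilb_eq_rho 4 _ j _ hD i (j - i) (by omega)]
        rcases Nat.le_total (2 * i) j with h' | h'
        · rw [rho_phi j A B C i (j - i) (by omega) (by omega) hC2 hCB hBA hAj, hs i h']
        · rw [rho_symm, rho_phi j A B C (j - i) i (by omega) (by omega) hC2 hCB hBA hAj,
            hsym i (j - i) (by omega), hs (j - i) (by omega)]
    · rintro ⟨ℓ, hℓ, _, hall⟩
      have hd : ∀ q r s : ℕ, q + r + s = 2 → q ≤ 1 → r ≤ 1 → s ≤ 1 →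
          ℓ ∣ monomial (ex 0 q r s) (1 : K) := by
        intro q r s h hq hr hs
        obtain ⟨m, _, hm⟩ := hall _ (XX_mem j A B C hA hB hC (by omega) q r s h hq hr hs)
          (isHomogeneous_monomial _ (by rw [ex_degree]; omega))
        exact ⟨m, hm⟩
      exact no_common ℓ hℓ (hd 1 1 0 rfl (by omega) (by omega) (by omega))
        (hd 1 0 1 rfl (by omega) (by omega) (by omega))
        (hd 0 1 1 rfl (by omega) (by omega) (by omega))
  · exact ⟨I₀, hAG, hH, hno⟩

end
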